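/- arXiv:2401.11282 — 5 statements merged into one kernel-verified Lean document; each statement's English description precedes it below -/
import Mathlib

section
/- Let V be a finite type, E : V → V → Prop a decidable edge relation, s : V, and d : ℕ. Define the relation α on V × ℕ by α (a, i) (b, j) := (E a b ∨ a = b) ∧ j = i + 1. Then for every x : V and every d : ℕ, Relation.ReflTransGen α (s, 0) (x, d) holds if and only if x is d-reachable from s. (Correctness of the positive transitive-closure formula dist(x,d) from Claim 1.) -/
/-- `x` is reachable from `s` by a path of length at most `d`. -/
def reachIn {V : Type*} (E : V → V → Prop) (d : ℕ) (s x : V) : Prop :=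
  ∃ k ≤ d, ∃ v : ℕ → V, v 0 = s ∧ v k = x ∧ ∀ i < k, E (v i) (v (i + 1))

theorem reachIn_self {V : Type*} (E : V → V → Prop) (d : ℕ) (s : V) : reachIn E d s s :=
  ⟨0, d.zero_le, fun _ => s, rfl, rfl, fun _ hi => absurd hi (Nat.not_lt_zero _)⟩

theorem reachIn.mono {V : Type*} {E : V → V → Prop} {d e : ℕ} {s x : V}
    (h : reachIn E d s x) (hde : d ≤ e) : reachIn E e s x := by
  obtain ⟨k, hk, hv⟩ := h
  exact ⟨k, hk.trans hde, hv⟩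

theorem reachIn.tail {V : Type*} {E : V → V → Prop} {d : ℕ} {s x y : V}
    (h : reachIn E d s x) (hxy : E x y) : reachIn E (d + 1) s y := by
  obtain ⟨k, hk, v, h0, hvk, hv⟩ := h
  refine ⟨k + 1, Nat.succ_le_succ hk, fun i => if i ≤ k then v i else y, by simpa, by simp, ?_⟩
  intro i hi
  rcases Nat.lt_succ_iff_lt_or_eq.mp hi with hi | rfl
  · simpa [hi.le, Nat.succ_le_of_lt hi] using hv i hi
  · simpa [hvk] using hxy

theorem dist_correct {V : Type*} [Fintype V] [DecidableEq V]
    (E : V → V → Prop) [DecidableRel E] (s : V) :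
    ∀ (x : V) (d : ℕ),
      Relation.ReflTransGen
        (fun p q : V × ℕ => (E p.1 q.1 ∨ p.1 = q.1) ∧ q.2 = p.2 + 1) (s, 0) (x, d)
      ↔ reachIn E d s x := by
  intro x d
  constructor
  · intro h
    suffices H : ∀ q : V × ℕ, Relation.ReflTransGen
        (fun p q : V × ℕ => (E p.1 q.1 ∨ p.1 = q.1) ∧ q.2 = p.2 + 1) (s, 0) q →
        reachIn E q.2 s q.1 from H _ h
    intro q hq
    induction hq with
    | refl => exact reachIn_self E 0 s
    | tail _ hstep ih =>
      obtain ⟨hE | heq, hsucc⟩ := hstep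
      · exact hsucc ▸ ih.tail hE
      · exact hsucc ▸ heq ▸ ih.mono (Nat.le_succ _)
  · rintro ⟨k, hk, v, rfl, rfl, hv⟩
    have path : ∀ i ≤ k, Relation.ReflTransGen
        (fun p q : V × ℕ => (E p.1 q.1 ∨ p.1 = q.1) ∧ q.2 = p.2 + 1) (v 0, 0) (v i, i) := by
      intro i
      induction i with
      | zero => exact fun _ => .refl
      | succ i ih => exact fun hi => (ih (Nat.le_of_succ_le hi)).tail ⟨.inl (hv i hi), rfl⟩
    induction d, hk using Nat.le_induction with
    | base => exact path k le_rfl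
    | succ d _ ih => exact ih.tail ⟨.inr rfl, rfl⟩
end

section
/- Let V be a finite type, E : V → V → Prop a decidable edge relation, s : V, d : ℕ, and let n_d be the number of vertices d-reachable from s. Then for every vertex v : V, v is NOT (d+1)-reachable from s if and only if v ≠ s and there exists a finite set S : Finset V with S.card = n_d such that every u ∈ S is d-reachable from s, and for every u ∈ S one has u ≠ v and ¬ E u v. (Non-reachability at level d+1 is certified, given only the count n_d, by exhibiting n_d vertices d-reachable from s none of which equals v or has an edge to v; this is the correctness of the relation γ in the inductive-counting proof.) -/
theorem reachIn_mono {V : Type*} {E : V → V → Prop} {d e : ℕ} {s x : V} (hde : d ≤ e)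
    (h : reachIn E d s x) : reachIn E e s x := by
  obtain ⟨k, hk, p⟩ := h
  exact ⟨k, hk.trans hde, p⟩

theorem reachIn_succ_iff {V : Type*} {E : V → V → Prop} {d : ℕ} {s x : V} :
    reachIn E (d + 1) s x ↔ x = s ∨ ∃ u, reachIn E d s u ∧ E u x := by
  constructor
  · rintro ⟨k, hk, p, h0, hkx, hp⟩
    cases k with
    | zero => exact Or.inl (hkx.symm.trans h0)
    | succ k =>
      exact Or.inr ⟨p k, ⟨k, by omega, p, h0, rfl, fun i hi => hp i (by omega)⟩,
        hkx ▸ hp k k.lt_succ_self⟩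
  · rintro (rfl | ⟨u, ⟨k, hk, p, h0, hku, hp⟩, hux⟩)
    · exact ⟨0, Nat.zero_le _, fun _ => x, rfl, rfl, by simp⟩
    · refine ⟨k + 1, by omega, fun i => if i ≤ k then p i else x, by simpa using h0, by simp, ?_⟩
      intro i hi
      rcases Nat.lt_succ_iff_lt_or_eq.mp hi with hi | rfl
      · simpa [hi.le, Nat.succ_le_of_lt hi] using hp i hi
      · simpa [hku] using hux

theorem gamma_nonreach_certificate {V : Type*} [Fintype V] [DecidableEq V]
    (E : V → V → Prop) [DecidableRel E] (s : V) (d : ℕ) :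
    ∀ v : V,
      ¬ reachIn E (d + 1) s v ↔
        v ≠ s ∧ ∃ S : Finset V, S.card = {w : V | reachIn E d s w}.ncard ∧
          (∀ u ∈ S, reachIn E d s u) ∧ ∀ u ∈ S, u ≠ v ∧ ¬ E u v := by
  intro v
  constructor
  · intro hv
    refine ⟨fun h => hv (reachIn_succ_iff.mpr (Or.inl h)),
      (Set.toFinite {w : V | reachIn E d s w}).toFinset,
      (Set.ncard_eq_toFinset_card _ _).symm, fun u hu => by simpa using hu, fun u hu => ?_⟩
    have hu : reachIn E d s u := by simpa using hu
    exact ⟨fun h => hv (reachIn_mono d.le_succ (h ▸ hu)),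
      fun h => hv (reachIn_succ_iff.mpr (Or.inr ⟨u, hu, h⟩))⟩
  · rintro ⟨hvs, S, hcard, hS, hSv⟩ hv
    have hS_eq : (S : Set V) = {w : V | reachIn E d s w} :=
      Set.eq_of_subset_of_ncard_le hS (by rw [Set.ncard_coe_finset, hcard]) (Set.toFinite _)
    obtain ⟨u, hu, huv⟩ := (reachIn_succ_iff.mp hv).resolve_left hvs
    have hu_mem : u ∈ (S : Set V) := hS_eq ▸ hu
    exact (hSv u hu_mem).2 huv
end

section
/- Let V be a finite type with n = Fintype.card V ≥ 1, E : V → V → Prop a decidable edge relation, and s, x : V. Then x is NOT reachable from s (¬ Relation.ReflTransGen E s x) if and only if there exists m : ℕ such that m = n_{n−1} (the number of vertices (n−1)-reachable from s) and m ≤ card {v : V | v ≠ x ∧ reachIn E (n−1) s v}. (This is the final equation of the proof that FO(pos TC) = FO(TC): non-reachability of x is expressed by guessing the total reachable count m and verifying that m vertices other than x are reachable.) -/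
theorem reachIn.reflTransGen {V : Type*} {E : V → V → Prop} {d : ℕ} {s x : V}
    (h : reachIn E d s x) : Relation.ReflTransGen E s x := by
  obtain ⟨k, -, v, rfl, rfl, hv⟩ := h
  induction k with
  | zero => exact .refl
  | succ k ih => exact (ih fun i hi => hv i (by omega)).tail (hv k (by omega))

theorem exists_reachIn_of_reflTransGen {V : Type*} {E : V → V → Prop} {s x : V}
    (h : Relation.ReflTransGen E s x) : ∃ d, reachIn E d s x := by
  induction h with
  | refl => exact ⟨0, 0, le_rfl, fun _ => s, rfl, rfl, by simp⟩
  | @tail b c _ hbc ih =>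
    obtain ⟨_, k, -, v, h0, hk, hv⟩ := ih
    refine ⟨k + 1, k + 1, le_rfl, fun i => if i ≤ k then v i else c, by simpa using h0,
      by simp, fun i hi => ?_⟩
    rcases (Nat.lt_succ_iff.mp hi).lt_or_eq with hlt | rfl
    · simpa [hlt.le, Nat.succ_le_of_lt hlt] using hv i hlt
    · simpa [hk] using hbc

/-- A shortest path visits no vertex twice, so it has fewer edges than there are vertices. -/
theorem reachIn.card_sub_one {V : Type*} [Fintype V] {E : V → V → Prop} {d : ℕ} {s x : V}
    (h : reachIn E d s x) : reachIn E (Fintype.card V - 1) s x := by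
  classical
  have hex : ∃ d, reachIn E d s x := ⟨d, h⟩
  obtain ⟨k, hk, v, h0, hx, hv⟩ := Nat.find_spec hex
  have hmin : ∀ m, reachIn E m s x → k ≤ m := fun m hm => hk.trans (Nat.find_min' hex hm)
  have hne : ∀ i j, i < j → j ≤ k → v i ≠ v j := by
    intro i j hij hjk heq
    have hshort : reachIn E (k - (j - i)) s x := by
      refine ⟨k - (j - i), le_rfl, fun t => if t ≤ i then v t else v (t + (j - i)),
        by simpa using h0, ?_, fun t ht => ?_⟩
      · dsimp only
        rcases hjk.eq_or_lt with rfl | hlt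
        · rw [if_pos (by omega), show j - (j - i) = i by omega, heq, hx]
        · rw [if_neg (by omega), show k - (j - i) + (j - i) = k by omega, hx]
      · rcases lt_trichotomy t i with hti | rfl | hti
        · simpa [hti.le, Nat.succ_le_of_lt hti] using hv t (by omega)
        · have hstep := hv j (by omega)
          simpa [heq, show t + 1 + (j - t) = j + 1 by omega] using hstep
        · have hstep := hv (t + (j - i)) (by omega)
          simpa [show ¬ t ≤ i by omega, show ¬ t + 1 ≤ i by omega,
            show t + 1 + (j - i) = t + (j - i) + 1 by omega] using hstep
    have := hmin _ hshort
    omega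
  have hinj : Function.Injective fun i : Fin (k + 1) => v i := by
    intro i j hij
    rcases lt_trichotomy i j with hlt | heq | hlt
    · exact absurd hij (hne i j hlt (by omega))
    · exact heq
    · exact absurd hij.symm (hne j i hlt (by omega))
  have hcard := Fintype.card_le_of_injective _ hinj
  rw [Fintype.card_fin] at hcard
  exact ⟨k, by omega, v, h0, hx, hv⟩

theorem reachIn_card_sub_one_iff {V : Type*} [Fintype V] {E : V → V → Prop} {s x : V} :
    reachIn E (Fintype.card V - 1) s x ↔ Relation.ReflTransGen E s x :=
  ⟨reachIn.reflTransGen, fun h => (exists_reachIn_of_reflTransGen h).choose_spec.card_sub_one⟩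

theorem nonreach_final_formula {V : Type*} [Fintype V] [DecidableEq V]
    (E : V → V → Prop) [DecidableRel E] (s x : V) (hn : 1 ≤ Fintype.card V) :
    ¬ Relation.ReflTransGen E s x ↔
      ∃ m : ℕ, m = {v : V | reachIn E (Fintype.card V - 1) s v}.ncard ∧
        m ≤ {v : V | v ≠ x ∧ reachIn E (Fintype.card V - 1) s v}.ncard := by
  rw [exists_eq_left, ← reachIn_card_sub_one_iff]
  constructor
  · intro hx
    refine Set.ncard_le_ncard (fun v hv => ⟨?_, hv⟩) (Set.toFinite _)
    rintro rfl
    exact hx hv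
  · intro hle hx
    refine hle.not_gt (Set.ncard_lt_ncard ?_ (Set.toFinite _))
    exact ⟨fun v hv => hv.2, fun hsub => (hsub hx).1 rfl⟩
end

section
/- Identify the three colors with elements of Fin 3: T = 0 (true), F = 1 (false), R = 2 (red). Let p, q, r ∈ ({T, F} : Set (Fin 3)) be given colors of the three literal vertices of a clause. Then there exist colors a, b, c, d, e, f : Fin 3 such that a ≠ p, b ≠ q, c ≠ r, f = T, and the endpoints of each gadget edge receive distinct colors — namely a ≠ b, a ≠ d, b ≠ d, d ≠ e, e ≠ c, e ≠ f, c ≠ f — if and only if p = T ∨ q = T ∨ r = T. (Correctness of the six-vertex clause gadget in the reduction from 3-SAT to 3-COLOR: a 3-coloring of the literals extends to the gadget, with the output vertex f forced to color T by its edges to the F- and R-colored base vertices, exactly when at least one literal is colored true.) -/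
/-- Correctness of the six-vertex clause gadget:
colors are `Fin 3` with `T = 0` (true), `F = 1` (false), `R = 2` (red). -/
theorem clause_gadget_correct (p q r : Fin 3)
    (hp : p ∈ ({0, 1} : Set (Fin 3))) (hq : q ∈ ({0, 1} : Set (Fin 3)))
    (hr : r ∈ ({0, 1} : Set (Fin 3))) :
    (∃ a b c d e f : Fin 3,
        a ≠ p ∧ b ≠ q ∧ c ≠ r ∧ f = 0 ∧
        a ≠ b ∧ a ≠ d ∧ b ≠ d ∧ d ≠ e ∧ e ≠ c ∧ e ≠ f ∧ c ≠ f)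
      ↔ (p = 0 ∨ q = 0 ∨ r = 0) := by
  have hp' : p = 0 ∨ p = 1 := hp
  have hq' : q = 0 ∨ q = 1 := hq
  have hr' : r = 0 ∨ r = 1 := hr
  constructor
  · rintro ⟨a, b, c, d, e, f, hap, hbq, hcr, hf, hab, had, hbd, hde, hec, hef, hcf⟩
    by_contra! h
    omega
  · intro h
    by_cases hp0 : p = 0
    · exact ⟨1, 2, 2, 0, 1, 0, by omega⟩
    by_cases hq0 : q = 0
    · exact ⟨2, 1, 2, 0, 1, 0, by omega⟩
    exact ⟨0, 2, 1, 1, 2, 0, by omega⟩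
end

section
/- Let n, m : ℕ with n ≥ 1, and let C : Fin m → (Fin n × Bool) × (Fin n × Bool) × (Fin n × Bool) be a 3-CNF formula with m clauses over n Boolean variables, each clause a triple of literals (a literal is a pair (i, b) : Fin n × Bool, with b = true for the positive literal xᵢ and b = false for ¬xᵢ). Define the simple graph G(C) on the vertex set (Fin 3) ⊕ (Fin n × Bool) ⊕ (Fin m × Fin 6) as follows, writing T, F, R for the three vertices of Fin 3 and, for each clause index i, writing a_i, b_i, c_i, d_i, e_i, f_i for the six vertices (i, 0), …, (i, 5) of gadget i. The edges (symmetrized, no loops) are: the base triangle T–F, T–R, F–R; for each variable j : Fin n, the ladder edges (j,true)–(j,false), (j,true)–R, (j,false)–R; and for each clause i with literals ℓ₁, ℓ₂, ℓ₃, the gadget edges ℓ₁–a_i, ℓ₂–b_i, ℓ₃–c_i, a_i–b_i, a_i–d_i, b_i–d_i, d_i–e_i, e_i–c_i, e_i–f_i, c_i–f_i, f_i–F, f_i–R. Then G(C) is 3-colorable (SimpleGraph.Colorable (G C) 3) if and only if C is satisfiable, i.e., there exists an assignment v : Fin n → Bool such that every clause contains a literal (j, b) with v j = b. (Correctness of the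 reduction 3-SAT ≤ 3-COLOR of Proposition 2.) -/
/-- Vertex set of the graph produced by the reduction 3-SAT ≤ 3-COLOR:
three base vertices `T, F, R`, a literal vertex for each pair `(j, b)`,
and six gadget vertices per clause. -/
abbrev ColVtx (n m : ℕ) := (Fin 3) ⊕ ((Fin n × Bool) ⊕ (Fin m × Fin 6))

/-- The base vertex `k` (`T = 0`, `F = 1`, `R = 2`). -/
def baseV {n m : ℕ} (k : Fin 3) : ColVtx n m := Sum.inl k

/-- The literal vertex `ℓ`. -/
def litV {n m : ℕ} (ℓ : Fin n × Bool) : ColVtx n m := Sum.inr (Sum.inl ℓ)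

/-- The `j`-th vertex (`a_i, b_i, c_i, d_i, e_i, f_i` for `j = 0,…,5`)
of the gadget of clause `i`. -/
def gadV {n m : ℕ} (i : Fin m) (j : Fin 6) : ColVtx n m := Sum.inr (Sum.inr (i, j))

/-- The edges of the reduction graph, prior to symmetrization. -/
def colEdges {n m : ℕ}
    (C : Fin m → (Fin n × Bool) × (Fin n × Bool) × (Fin n × Bool))
    (u v : ColVtx n m) : Prop :=
  -- base triangle T–F, T–R, F–R
  (u = baseV 0 ∧ v = baseV 1) ∨ (u = baseV 0 ∧ v = baseV 2) ∨
  (u = baseV 1 ∧ v = baseV 2) ∨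
  -- ladder: (j,true)–(j,false), (j,true)–R, (j,false)–R
  (∃ j : Fin n,
    (u = litV (j, true) ∧ v = litV (j, false)) ∨
    (u = litV (j, true) ∧ v = baseV 2) ∨
    (u = litV (j, false) ∧ v = baseV 2)) ∨
  -- clause gadgets
  (∃ i : Fin m,
    (u = litV (C i).1 ∧ v = gadV i 0) ∨        -- ℓ₁–a_i
    (u = litV (C i).2.1 ∧ v = gadV i 1) ∨      -- ℓ₂–b_i
    (u = litV (C i).2.2 ∧ v = gadV i 2) ∨      -- ℓ₃–c_i
    (u = gadV i 0 ∧ v = gadV i 1) ∨            -- a_i–b_i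
    (u = gadV i 0 ∧ v = gadV i 3) ∨            -- a_i–d_i
    (u = gadV i 1 ∧ v = gadV i 3) ∨            -- b_i–d_i
    (u = gadV i 3 ∧ v = gadV i 4) ∨            -- d_i–e_i
    (u = gadV i 4 ∧ v = gadV i 2) ∨            -- e_i–c_i
    (u = gadV i 4 ∧ v = gadV i 5) ∨            -- e_i–f_i
    (u = gadV i 2 ∧ v = gadV i 5) ∨            -- c_i–f_i
    (u = gadV i 5 ∧ v = baseV 1) ∨             -- f_i–F
    (u = gadV i 5 ∧ v = baseV 2))              -- f_i–R

/-- The graph `G(C)` of the reduction: the symmetric, irreflexive closure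
of the listed edges. -/
def G {n m : ℕ} (C : Fin m → (Fin n × Bool) × (Fin n × Bool) × (Fin n × Bool)) :
    SimpleGraph (ColVtx n m) := SimpleGraph.fromRel (colEdges C)

/-- In a 3-coloring of the clause gadget whose three inputs all have the color `f` of the
base vertex `F`, some edge is monochromatic. -/
lemma gadget_inputs_ne_false (f x y z a b c d e o : Fin 3)
    (hxa : x ≠ a) (hyb : y ≠ b) (hzc : z ≠ c) (hab : a ≠ b) (had : a ≠ d)
    (hbd : b ≠ d) (hde : d ≠ e) (hec : e ≠ c) (heo : e ≠ o) (hco : c ≠ o) (hof : o ≠ f) :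
    ¬ (x = f ∧ y = f ∧ z = f) := by
  rintro ⟨hx, hy, hz⟩
  have hd : d = f := by omega
  have he : e = f := by omega
  exact hde (hd.trans he.symm)

set_option synthInstance.maxSize 1024 in
/-- If one of the inputs of the clause gadget has the color `0` of `T` and the others have
color `0` or `1`, the coloring extends to the gadget. -/
lemma exists_gadget_coloring (p q s : Bool) (h : p = true ∨ q = true ∨ s = true) :
    ∃ a b c d e : Fin 3, (if p then 0 else 1) ≠ a ∧ (if q then 0 else 1) ≠ b ∧
      (if s then 0 else 1) ≠ c ∧ a ≠ b ∧ a ≠ d ∧ b ≠ d ∧ d ≠ e ∧ e ≠ c ∧ e ≠ 0 ∧ c ≠ 0 := by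
  revert p q s
  decide

/-- The graph has a 3-coloring iff some map to `Fin 3` separates the ends of each listed edge. -/
lemma colorable_G_iff {n m : ℕ}
    (C : Fin m → (Fin n × Bool) × (Fin n × Bool) × (Fin n × Bool)) :
    (G C).Colorable 3 ↔ ∃ c : ColVtx n m → Fin 3, ∀ u v, colEdges C u v → c u ≠ c v := by
  constructor
  · rintro ⟨c⟩
    refine ⟨c, fun u v huv ↦ c.valid ?_⟩
    refine (SimpleGraph.fromRel_adj _ _ _).2 ⟨?_, Or.inl huv⟩
    rintro rfl
    simp only [colEdges] at huv
    rcases huv with h | h | h | ⟨j, h | h | h⟩ |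
      ⟨i, h | h | h | h | h | h | h | h | h | h | h | h⟩ <;>
    · have := h.1.symm.trans h.2
      simp [baseV, litV, gadV] at this
  · rintro ⟨c, hc⟩
    refine ⟨SimpleGraph.Coloring.mk c fun {u v} huv ↦ ?_⟩
    rcases ((SimpleGraph.fromRel_adj _ _ _).1 huv).2 with h | h
    · exact hc u v h
    · exact (hc v u h).symm

/-- Correctness of the reduction 3-SAT ≤ 3-COLOR:
`G(C)` is 3-colorable iff `C` is satisfiable. -/
theorem threeSat_reduces_to_threeCol {n m : ℕ} (hn : 1 ≤ n)
    (C : Fin m → (Fin n × Bool) × (Fin n × Bool) × (Fin n × Bool)) :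
    (G C).Colorable 3 ↔
      ∃ v : Fin n → Bool, ∀ i : Fin m,
        v (C i).1.1 = (C i).1.2 ∨ v (C i).2.1.1 = (C i).2.1.2 ∨
          v (C i).2.2.1 = (C i).2.2.2 := by
  rw [colorable_G_iff]
  constructor
  · rintro ⟨c, hc⟩
    have htf := hc (baseV 0) (baseV 1) (by simp [colEdges])
    have htr := hc (baseV 0) (baseV 2) (by simp [colEdges])
    have hfr := hc (baseV 1) (baseV 2) (by simp [colEdges])
    refine ⟨fun j ↦ decide (c (litV (j, true)) = c (baseV 0)), fun i ↦ ?_⟩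
    have hlit (l : Fin n × Bool)
        (hl : decide (c (litV (l.1, true)) = c (baseV 0)) ≠ l.2) :
        c (litV l) = c (baseV 1) := by
      obtain ⟨j, b⟩ := l
      have hlad (u v : ColVtx n m) (h : _) :=
        hc u v (Or.inr (Or.inr (Or.inr (Or.inl ⟨j, h⟩))))
      have h1 := hlad (litV (j, true)) (litV (j, false)) (by simp)
      have h2 := hlad (litV (j, true)) (baseV 2) (by simp)
      have h3 := hlad (litV (j, false)) (baseV 2) (by simp)
      cases b <;> simp at hl <;> omega
    have hgad (u v : ColVtx n m) (h : _) := hc u v (Or.inr (Or.inr (Or.inr (Or.inr ⟨i, h⟩))))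
    by_contra! h
    refine gadget_inputs_ne_false (c (baseV 1)) _ _ _
      (c (gadV i 0)) (c (gadV i 1)) (c (gadV i 2)) (c (gadV i 3)) (c (gadV i 4)) (c (gadV i 5))
      ?_ ?_ ?_ ?_ ?_ ?_ ?_ ?_ ?_ ?_ ?_ ⟨hlit _ h.1, hlit _ h.2.1, hlit _ h.2.2⟩ <;>
    · apply hgad
      simp
  · rintro ⟨v, hv⟩
    have hgad (i : Fin m) := exists_gadget_coloring (v (C i).1.1 == (C i).1.2)
      (v (C i).2.1.1 == (C i).2.1.2) (v (C i).2.2.1 == (C i).2.2.2) (by simpa using hv i)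
    simp only [beq_iff_eq] at hgad
    choose a b c d e hg using hgad
    refine ⟨Sum.elim id (Sum.elim (fun l ↦ if v l.1 = l.2 then 0 else 1)
      fun p ↦ ![a p.1, b p.1, c p.1, d p.1, e p.1, 0] p.2), fun u w huw ↦ ?_⟩
    rcases huw with h | h | h | ⟨j, h | h | h⟩ |
      ⟨i, h | h | h | h | h | h | h | h | h | h | h | h⟩ <;>
    obtain ⟨rfl, rfl⟩ := h
    iterate 3 simp [baseV]
    iterate 3 cases hj : v j <;> simp [baseV, litV, hj]
    all_goals
      obtain ⟨h1, h2, h3, h4, h5, h6, h7, h8, h9, h10⟩ := hg i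
      simp [baseV, litV, gadV, *]
end
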